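/- Let G be a step-2 Carnot group in exponential coordinates as below, with complementary subgroups 𝕎 and 𝕃, let φ̃: 𝕎 → 𝕃 be intrinsic L-Lipschitz with scalar component φ, and let γ̃: I → 𝕎 be an absolutely continuous curve horizontal for the vector fields {D_j^φ}_{j=2,…,m} with controls (a₂,…,a_m) ∈ L¹. Then: (i) the length, with respect to the left-invariant homogeneous distance d of G, of the graph curve t ↦ γ̃(t)·φ̃(γ̃(t)) is at most C·ℓ_φ(γ̃), where C = C(G,L); and (ii) if moreover |a(t)| ≤ K for a.e. t, then the scalar function s ↦ φ(γ̃(s)) is L'-Lipschitz with L' = L'(L,K,G). -/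

import Mathlib

open Metric MeasureTheory
open scoped ENNReal Topology

namespace Step2

/-- Points of a step-2 Carnot group in exponential coordinates: `ℝ^m × ℝ^n`. -/
abbrev Pt (m n : ℕ) := (Fin m → ℝ) × (Fin n → ℝ)

variable {m n : ℕ}

/-- The group operation of the step-2 Carnot group with (skew-symmetric, linearly
independent) structure matrices `B¹, …, Bⁿ`:
`(x,y)·(x̃,ỹ) = (x + x̃, (y_k + ỹ_k + ½ Σ_{j,l} B^k_{jl} x̃_j x_l)_k)`. -/
noncomputable def mul (B : Fin n → Fin m → Fin m → ℝ) (p q : Pt m n) : Pt m n :=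
  (p.1 + q.1, fun k => p.2 k + q.2 k + (1 / 2) * ∑ j, ∑ l, B k j l * q.1 j * p.1 l)

/-- Inversion: in exponential coordinates of a step-2 group it is negation. -/
def inv (p : Pt m n) : Pt m n := (-p.1, -p.2)

/-- The intrinsic dilations `δ_λ(x, y) = (λx, λ²y)`. -/
def dil (lam : ℝ) (p : Pt m n) : Pt m n := (lam • p.1, (lam ^ 2) • p.2)

/-- `d` is a left-invariant homogeneous distance on the step-2 group with matrices `B`. -/
structure IsLIHomDist (B : Fin n → Fin m → Fin m → ℝ) (d : Pt m n → Pt m n → ℝ) :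
    Prop where
  self : ∀ p, d p p = 0
  eq_of_dist_eq_zero : ∀ p q, d p q = 0 → p = q
  symm : ∀ p q, d p q = d q p
  triangle : ∀ p q r, d p r ≤ d p q + d q r
  left_invariant : ∀ z p q, d (mul B z p) (mul B z q) = d p q
  homogeneous : ∀ lam : ℝ, 0 < lam → ∀ p q, d (dil lam p) (dil lam q) = lam * d p q

/-- The projection onto the horizontal subgroup `𝕃 = {(x₁, 0, …, 0)}`. -/
def projL [NeZero m] (p : Pt m n) : Pt m n := ((Pi.single 0 (p.1 0) : Fin m → ℝ), 0)

/-- The projection onto the complementary (vertical, normal) subgroup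
`𝕎 = {(0, x₂, …, x_m, y)}`: the unique `p_𝕎` with `p = p_𝕎 · p_𝕃`. -/
noncomputable def projW [NeZero m] (B : Fin n → Fin m → Fin m → ℝ) (p : Pt m n) : Pt m n :=
  mul B p (inv (projL p))

/-- The graph point `w · φ̃(w)` over `w ∈ 𝕎`, where `φ̃ : 𝕎 → 𝕃` has scalar component
`φv`, i.e. `φ̃(w) = (φv w, 0, …, 0)`. -/
noncomputable def graphPt [NeZero m] (B : Fin n → Fin m → Fin m → ℝ) (φv : Pt m n → ℝ) (w : Pt m n) :
    Pt m n :=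
  mul B w ((Pi.single 0 (φv w) : Fin m → ℝ), 0)

/-- `φ̃ : 𝕎 → 𝕃` (with scalar component `φv`) is intrinsic `L`-Lipschitz: for every point
`p` of its graph, the cone `C_{𝕎,𝕃}(p, 1/L) = p · {q : d(q_𝕎, e) ≤ (1/L) d(q_𝕃, e)}`
meets the graph only at `p`. -/
def IsIntrinsicLip [NeZero m] (B : Fin n → Fin m → Fin m → ℝ)
    (d : Pt m n → Pt m n → ℝ) (L : ℝ) (φv : Pt m n → ℝ) : Prop :=
  ∀ w w' : Pt m n, w.1 0 = 0 → w'.1 0 = 0 →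
    d (projW B (mul B (inv (graphPt B φv w)) (graphPt B φv w'))) 0
        ≤ (1 / L) * d (projL (mul B (inv (graphPt B φv w)) (graphPt B φv w'))) 0 →
    w = w'

/-- `(γ1, γ2) : [t₀, t₁] → 𝕎` is an absolutely continuous curve, horizontal for the
vector fields `{D_j^φ}_{j=2,…,m}` (where
`D_j^φ = X_j + φ B^k_{j1} Y_k = ∂_{x_j} + (½ B^k_{jl} x_l + φ B^k_{j1}) ∂_{y_k}`),
with controls `a ∈ L¹([t₀,t₁]; ℝ^{m-1})`. -/
structure IsHorizontalForD [NeZero m] (B : Fin n → Fin m → Fin m → ℝ)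
    (φv : Pt m n → ℝ) (t₀ t₁ : ℝ) (γ1 : ℝ → Fin m → ℝ) (γ2 : ℝ → Fin n → ℝ)
    (a : ℝ → Fin m → ℝ) : Prop where
  le : t₀ ≤ t₁
  ctrl_zero : ∀ t, a t 0 = 0
  mem_W : ∀ t ∈ Set.Icc t₀ t₁, γ1 t 0 = 0
  integrable : IntegrableOn a (Set.Icc t₀ t₁)
  horiz : ∀ t ∈ Set.Icc t₀ t₁, ∀ j, γ1 t j = γ1 t₀ j + ∫ s in t₀..t, a s j
  vert : ∀ t ∈ Set.Icc t₀ t₁, ∀ k, γ2 t k = γ2 t₀ k +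
    ∫ s in t₀..t,
      ∑ j, a s j * ((1 / 2) * ∑ l, B k j l * γ1 s l + φv (γ1 s, γ2 s) * B k j 0)

/-- The `φ`-length `ℓ_φ` of a horizontal curve with controls `a`:
`∫ √(a₂² + ⋯ + a_m²)`. -/
noncomputable def phiLength (t₀ t₁ : ℝ) (a : ℝ → Fin m → ℝ) : ℝ :=
  ∫ s in t₀..t₁, Real.sqrt (∑ j, (a s j) ^ 2)

/-- the bilinear form of the `k`-th structure matrix -/
noncomputable def bil (B : Fin n → Fin m → Fin m → ℝ) (k : Fin n) (u v : Fin m → ℝ) : ℝ :=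
  ∑ j, ∑ l, B k j l * u j * v l

lemma mul_def' (B : Fin n → Fin m → Fin m → ℝ) (p q : Pt m n) :
    mul B p q = (p.1 + q.1, fun k => p.2 k + q.2 k + (1 / 2) * bil B k q.1 p.1) := rfl

lemma bil_add_left (B : Fin n → Fin m → Fin m → ℝ) (k : Fin n) (u u' v : Fin m → ℝ) :
    bil B k (u + u') v = bil B k u v + bil B k u' v := by
  simp only [bil, Pi.add_apply, mul_add, add_mul, Finset.sum_add_distrib]

lemma bil_add_right (B : Fin n → Fin m → Fin m → ℝ) (k : Fin n) (u v v' : Fin m → ℝ) :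
    bil B k u (v + v') = bil B k u v + bil B k u v' := by
  simp only [bil, Pi.add_apply, mul_add, Finset.sum_add_distrib]

lemma bil_neg_left (B : Fin n → Fin m → Fin m → ℝ) (k : Fin n) (u v : Fin m → ℝ) :
    bil B k (-u) v = - bil B k u v := by
  simp only [bil, Pi.neg_apply, mul_neg, neg_mul, Finset.sum_neg_distrib]

lemma bil_neg_right (B : Fin n → Fin m → Fin m → ℝ) (k : Fin n) (u v : Fin m → ℝ) :
    bil B k u (-v) = - bil B k u v := by
  simp only [bil, Pi.neg_apply, mul_neg, Finset.sum_neg_distrib]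

lemma bil_skew {B : Fin n → Fin m → Fin m → ℝ} (hskew : ∀ k j l, B k j l = -B k l j)
    (k : Fin n) (u v : Fin m → ℝ) : bil B k u v = - bil B k v u := by
  unfold bil
  rw [Finset.sum_comm, ← Finset.sum_neg_distrib]
  refine Finset.sum_congr rfl fun j _ => ?_
  rw [← Finset.sum_neg_distrib]
  refine Finset.sum_congr rfl fun l _ => ?_
  rw [hskew k l j]; ring

lemma bil_self {B : Fin n → Fin m → Fin m → ℝ} (hskew : ∀ k j l, B k j l = -B k l j)
    (k : Fin n) (u : Fin m → ℝ) : bil B k u u = 0 := by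
  have := bil_skew hskew k u u
  linarith

lemma bil_single [NeZero m] (B : Fin n → Fin m → Fin m → ℝ) (k : Fin n) (u : Fin m → ℝ) (c : ℝ) :
    bil B k u (Pi.single 0 c) = c * ∑ j, B k j 0 * u j := by
  unfold bil
  rw [Finset.mul_sum]
  refine Finset.sum_congr rfl fun j _ => ?_
  rw [Finset.sum_eq_single 0]
  · simp; ring
  · intro b _ hb; simp [Pi.single_eq_of_ne hb]
  · simp

lemma bil_zero_left (B : Fin n → Fin m → Fin m → ℝ) (k : Fin n) (v : Fin m → ℝ) :
    bil B k 0 v = 0 := by simp [bil]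

lemma bil_zero_right (B : Fin n → Fin m → Fin m → ℝ) (k : Fin n) (v : Fin m → ℝ) :
    bil B k v 0 = 0 := by simp [bil]

/-- sum of all absolute values of the coefficients -/
noncomputable def beta (B : Fin n → Fin m → Fin m → ℝ) : ℝ := ∑ k, ∑ j, ∑ l, |B k j l|

lemma beta_nonneg (B : Fin n → Fin m → Fin m → ℝ) : 0 ≤ beta B := by
  unfold beta; positivity

lemma row_le_beta (B : Fin n → Fin m → Fin m → ℝ) (k : Fin n) :
    ∑ j, ∑ l, |B k j l| ≤ beta B :=
  Finset.single_le_sum (f := fun k => ∑ j, ∑ l, |B k j l|)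
    (fun i _ => by positivity) (Finset.mem_univ k)

lemma bil_bound (B : Fin n → Fin m → Fin m → ℝ) (k : Fin n) (u v : Fin m → ℝ) (r s : ℝ)
    (hr : 0 ≤ r) (hu : ∀ j, |u j| ≤ r) (hv : ∀ j, |v j| ≤ s) :
    |bil B k u v| ≤ beta B * (r * s) := by
  by_cases hm : IsEmpty (Fin m)
  · simp [bil, beta]
  have hs : 0 ≤ s := by
    rw [not_isEmpty_iff] at hm
    obtain ⟨j⟩ := hm
    exact (abs_nonneg _).trans (hv j)
  calc |bil B k u v| ≤ ∑ j, ∑ l, |B k j l| * (r * s) := by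
        unfold bil
        refine (Finset.abs_sum_le_sum_abs _ _).trans (Finset.sum_le_sum fun j _ => ?_)
        refine (Finset.abs_sum_le_sum_abs _ _).trans (Finset.sum_le_sum fun l _ => ?_)
        rw [mul_assoc, abs_mul, abs_mul]
        have := hu j
        have := hv l
        gcongr
    _ = (∑ j, ∑ l, |B k j l|) * (r * s) := by simp only [Finset.sum_mul]
    _ ≤ _ := by
        have := row_le_beta B k
        gcongr

section dist
variable {B : Fin n → Fin m → Fin m → ℝ} {d : Pt m n → Pt m n → ℝ}

lemma inv_mul_self' (hskew : ∀ k j l, B k j l = -B k l j) (p : Pt m n) :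
    mul B (inv p) p = 0 := by
  rw [mul_def']
  ext k
  · simp [inv]
  · simp [inv, bil_neg_right, bil_self hskew]

lemma mul_zero' (p : Pt m n) : mul B p 0 = p := by
  rw [mul_def']
  ext k
  · simp
  · simp [bil_zero_left]

lemma d_nonneg (hd : IsLIHomDist B d) (p q : Pt m n) : 0 ≤ d p q := by
  have h1 := hd.triangle p q p
  rw [hd.self, hd.symm q p] at h1
  linarith

lemma d_left (hskew : ∀ k j l, B k j l = -B k l j) (hd : IsLIHomDist B d) (p q : Pt m n) :
    d p q = d (mul B (inv p) q) 0 := by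
  rw [← hd.left_invariant (inv p) p q, inv_mul_self' hskew, hd.symm]

lemma d_inv (hskew : ∀ k j l, B k j l = -B k l j) (hd : IsLIHomDist B d) (p : Pt m n) :
    d (inv p) 0 = d p 0 := by
  rw [d_left hskew hd p 0, mul_zero']

lemma d_mul (hd : IsLIHomDist B d) (p q : Pt m n) :
    d (mul B p q) 0 ≤ d p 0 + d q 0 := by
  have h1 := hd.triangle (mul B p q) (mul B p 0) 0
  rw [hd.left_invariant, mul_zero'] at h1
  linarith

lemma d_dil (hd : IsLIHomDist B d) (r : ℝ) (hr : 0 < r) (p : Pt m n) :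
    d (dil r p) 0 = r * d p 0 := by
  have h := hd.homogeneous r hr p 0
  have h0 : dil r (0 : Pt m n) = 0 := by simp [dil]
  rwa [h0] at h

lemma d_single_x (hskew : ∀ k j l, B k j l = -B k l j) (hd : IsLIHomDist B d) (j : Fin m) (c : ℝ) :
    d (Pi.single j c, 0) 0 = |c| * d (Pi.single j 1, 0) 0 := by
  have key : ∀ c : ℝ, 0 < c → d (Pi.single j c, 0) 0 = c * d (Pi.single j 1, 0) 0 := by
    intro c hc
    rw [← d_dil hd c hc]
    congr 1
    simp only [dil, smul_zero, ← Pi.single_smul, smul_eq_mul, mul_one]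
  rcases lt_trichotomy c 0 with h | h | h
  · rw [← d_inv hskew hd, abs_of_neg h, ← key (-c) (by linarith)]
    simp [inv, Pi.single_neg]
  · subst h
    simp only [Pi.single_zero, abs_zero, zero_mul]
    exact hd.self 0
  · rw [abs_of_pos h, key c h]

lemma d_single_y (hskew : ∀ k j l, B k j l = -B k l j) (hd : IsLIHomDist B d) (k : Fin n) (c : ℝ) :
    d (0, Pi.single k c) 0 = √|c| * d (0, Pi.single k 1) 0 := by
  have key : ∀ c : ℝ, 0 < c → d (0, Pi.single k c) 0 = √c * d (0, Pi.single k 1) 0 := by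
    intro c hc
    rw [← d_dil hd (√c) (Real.sqrt_pos.2 hc)]
    congr 1
    simp only [dil, smul_zero, ← Pi.single_smul, smul_eq_mul, mul_one, Real.sq_sqrt hc.le]
  rcases lt_trichotomy c 0 with h | h | h
  · rw [← d_inv hskew hd, abs_of_neg h, ← key (-c) (by linarith)]
    simp [inv, Pi.single_neg]
  · subst h
    simp only [Pi.single_zero, abs_zero, Real.sqrt_zero, zero_mul]
    exact hd.self 0
  · rw [abs_of_pos h, key c h]

lemma vert_bound (hskew : ∀ k j l, B k j l = -B k l j) (hd : IsLIHomDist B d) :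
    ∃ C ≥ (0 : ℝ), ∀ (R : ℝ) (y : Fin n → ℝ), (∀ k, |y k| ≤ R) → d (0, y) 0 ≤ C * √R := by
  refine ⟨∑ k, d (0, Pi.single k 1) 0, Finset.sum_nonneg fun k _ => d_nonneg hd _ _, ?_⟩
  intro R y hy
  have key : ∀ s : Finset (Fin n), d (0, ∑ k ∈ s, Pi.single k (y k)) 0
      ≤ (∑ k ∈ s, d (0, Pi.single k 1) 0) * √R := by
    intro s
    induction s using Finset.induction_on with
    | empty =>
      rw [Finset.sum_empty, Finset.sum_empty, zero_mul]
      exact (hd.self 0).le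
    | insert k s hk ih =>
      rw [Finset.sum_insert hk, Finset.sum_insert hk, add_mul]
      have e : ((0, Pi.single k (y k) + ∑ k ∈ s, Pi.single k (y k)) : Pt m n)
          = mul B (0, Pi.single k (y k)) (0, ∑ k ∈ s, Pi.single k (y k)) := by
        rw [mul_def']
        ext i
        · simp
        · simp [bil_zero_left]
      rw [e]
      refine (d_mul hd _ _).trans (add_le_add ?_ ih)
      rw [d_single_y hskew hd, mul_comm]
      exact mul_le_mul_of_nonneg_left (Real.sqrt_le_sqrt (hy k)) (d_nonneg hd _ _)
  have := key Finset.univ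
  rwa [Finset.univ_sum_single] at this

lemma horiz_bound (hskew : ∀ k j l, B k j l = -B k l j) (hd : IsLIHomDist B d) :
    ∃ C ≥ (0 : ℝ), ∀ (x : Fin m → ℝ), (∀ k, |x k| ≤ 1) → d (x, 0) 0 ≤ C := by
  obtain ⟨CV, hCV, hV⟩ := vert_bound hskew hd
  have key : ∀ s : Finset (Fin m), ∃ C ≥ (0 : ℝ), ∀ (x : Fin m → ℝ), (∀ k, |x k| ≤ 1) →
      d (∑ k ∈ s, Pi.single k (x k), 0) 0 ≤ C := by
    intro s
    induction s using Finset.induction_on with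
    | empty => exact ⟨0, le_rfl, fun x _ => by rw [Finset.sum_empty]; exact (hd.self 0).le⟩
    | insert j s hj ih =>
      obtain ⟨C, hC, h⟩ := ih
      refine ⟨d (Pi.single j 1, 0) 0 + C + CV * √(beta B), ?_, ?_⟩
      · have := d_nonneg hd (Pi.single j 1, 0) 0
        positivity
      intro x hx
      rw [Finset.sum_insert hj]
      set u : Fin m → ℝ := Pi.single j (x j) with hu
      set v : Fin m → ℝ := ∑ k ∈ s, Pi.single k (x k) with hv
      have e : ((u + v, 0) : Pt m n)
          = mul B (mul B (u, 0) (v, 0)) (0, fun k => - ((1/2) * bil B k v u)) := by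
        simp only [mul_def']
        ext i
        · simp
        · simp [bil_zero_left]
      rw [e]
      refine (d_mul hd _ _).trans (add_le_add ((d_mul hd _ _).trans (add_le_add ?_ (h x hx))) ?_)
      · rw [d_single_x hskew hd]
        have := d_nonneg hd (Pi.single j 1, 0) 0
        nlinarith [hx j]
      · apply hV
        intro k
        have h1 := bil_bound B k v u 1 1 zero_le_one ?_ ?_
        · rw [abs_neg, abs_mul, abs_of_nonneg (by norm_num : (0:ℝ) ≤ 1/2)]
          have := abs_nonneg (bil B k v u)
          linarith
        · intro i
          rw [hv, Finset.sum_apply]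
          simp only [Pi.single_apply]
          rw [Finset.sum_ite_eq]
          split_ifs
          · exact hx i
          · simp
        · intro i
          rw [hu, Pi.single_apply]
          split_ifs with h
          · exact hx j
          · simp
  obtain ⟨C, hC, h⟩ := key Finset.univ
  refine ⟨C, hC, fun x hx => ?_⟩
  have := h x hx
  rwa [Finset.univ_sum_single] at this

lemma box_bound (hskew : ∀ k j l, B k j l = -B k l j) (hd : IsLIHomDist B d) :
    ∃ C > (0 : ℝ), ∀ (r : ℝ) (p : Pt m n), 0 ≤ r → (∀ j, |p.1 j| ≤ r) → (∀ k, |p.2 k| ≤ r ^ 2) →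
      d p 0 ≤ C * r := by
  obtain ⟨CV, hCV, hV⟩ := vert_bound hskew hd
  obtain ⟨CH, hCH, hH⟩ := horiz_bound hskew hd
  have unit : ∀ p : Pt m n, (∀ j, |p.1 j| ≤ 1) → (∀ k, |p.2 k| ≤ 1) → d p 0 ≤ CH + CV + 1 := by
    intro p h1 h2
    have e : p = mul B (p.1, 0) (0, p.2) := by
      rw [mul_def']
      ext i
      · simp
      · simp [bil_zero_left]
    rw [e]
    have := d_mul hd (p.1, 0) (0, p.2)
    have a1 := hH p.1 h1
    have a2 := hV 1 p.2 h2
    rw [Real.sqrt_one] at a2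
    linarith
  refine ⟨CH + CV + 1, by positivity, ?_⟩
  intro r p hr h1 h2
  rcases hr.eq_or_lt with rfl | hr
  · have : p = 0 := by
      ext i
      · simpa using h1 i
      · simpa using h2 i
    rw [this, hd.self]; simp
  · have e : p = dil r (dil r⁻¹ p) := by
      simp only [dil, smul_smul]
      have : r ≠ 0 := hr.ne'
      have h3 : r ^ 2 * r⁻¹ ^ 2 = 1 := by field_simp
      rw [h3, mul_inv_cancel₀ this]; simp
    rw [e, d_dil hd r hr, mul_comm]
    refine mul_le_mul_of_nonneg_right (unit _ ?_ ?_) hr.le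
    · intro j
      simp only [dil, Pi.smul_apply, smul_eq_mul, abs_mul, abs_inv, abs_of_pos hr]
      rw [inv_mul_le_iff₀ hr]; simpa using h1 j
    · intro j
      simp only [dil, Pi.smul_apply, smul_eq_mul, abs_mul, abs_inv, abs_of_pos hr, abs_pow, inv_pow]
      rw [inv_mul_le_iff₀ (by positivity)]; simpa using h2 j

/-- vertical part of the `φ(w)`-conjugated difference -/
noncomputable def vdiff [NeZero m] (B : Fin n → Fin m → Fin m → ℝ) (f : ℝ) (w w' : Pt m n)
    (k : Fin n) : ℝ :=
  w'.2 k - w.2 k - (1/2) * bil B k (w'.1 - w.1) w.1 - f * ∑ j, B k j 0 * (w'.1 j - w.1 j)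

lemma graph_diff [NeZero m] (hskew : ∀ k j l, B k j l = -B k l j) (φv : Pt m n → ℝ) (w w' : Pt m n)
    (hw : w.1 0 = 0) (hw' : w'.1 0 = 0) :
    projL (mul B (inv (graphPt B φv w)) (graphPt B φv w')) = (Pi.single 0 (φv w' - φv w), 0) ∧
    projW B (mul B (inv (graphPt B φv w)) (graphPt B φv w')) =
      (w'.1 - w.1, fun k => vdiff B (φv w) w w' k) := by
  have h1 : projL (mul B (inv (graphPt B φv w)) (graphPt B φv w'))
      = (Pi.single 0 (φv w' - φv w), 0) := by
    simp only [projL, graphPt, inv, mul_def']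
    ext i
    · simp [hw, hw']; ring_nf
    · simp
  refine ⟨h1, ?_⟩
  rw [projW, h1]
  simp only [graphPt, inv, mul_def']
  have e : (Pi.single 0 (φv w' - φv w) : Fin m → ℝ) = Pi.single 0 (φv w') + - Pi.single 0 (φv w) := by
    rw [Pi.single_sub, sub_eq_add_neg]
  ext k
  · simp only [e, Pi.add_apply, Pi.neg_apply, Pi.sub_apply]; ring
  · have hb : ∑ j, B k j 0 * (w'.1 j - w.1 j)
       = ∑ j, B k j 0 * w'.1 j - ∑ j, B k j 0 * w.1 j := by
      simp only [mul_sub, Finset.sum_sub_distrib]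
    have hs : ∀ (c : ℝ) (u : Fin m → ℝ), bil B k (Pi.single 0 c) u = - (c * ∑ j, B k j 0 * u j) := by
      intro c u
      rw [bil_skew hskew, bil_single]
    have h00 : B k 0 0 = 0 := by have := hskew k 0 0; linarith
    have hss : ∀ c c' : ℝ, bil B k (Pi.single 0 c) (Pi.single 0 c') = 0 := by
      intro c c'
      rw [bil_single, Finset.sum_eq_single 0]
      · simp [h00]
      · intro b _ hb; simp [Pi.single_eq_of_ne hb]
      · simp
    simp only [vdiff, hb]
    simp only [e]
    simp only [sub_eq_add_neg, bil_add_left, bil_add_right, bil_neg_left,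
      bil_neg_right, neg_add, neg_neg, Pi.neg_apply, Pi.zero_apply, bil_self hskew, hss]
    simp only [bil_single, hs]
    ring

lemma lip_main [NeZero m] (hskew : ∀ k j l, B k j l = -B k l j) (hd : IsLIHomDist B d)
    (L : ℝ) (hL : 0 < L) :
    ∃ C ≥ (1 : ℝ), ∀ φv : Pt m n → ℝ, IsIntrinsicLip B d L φv → ∀ w w' : Pt m n,
      w.1 0 = 0 → w'.1 0 = 0 → ∀ r : ℝ, 0 ≤ r → (∀ j, |w'.1 j - w.1 j| ≤ r) →
      (∀ k, |vdiff B (φv w) w w' k| ≤ r ^ 2) →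
      |φv w' - φv w| ≤ C * r ∧ d (graphPt B φv w) (graphPt B φv w') ≤ C * r := by
  obtain ⟨C, hC, h⟩ := box_bound hskew hd
  set E := d ((Pi.single 0 1, 0) : Pt m n) 0 with hE
  have hE0 : 0 < E := by
    refine lt_of_le_of_ne (d_nonneg hd _ _) fun h0 => ?_
    have h1 := hd.eq_of_dist_eq_zero _ _ h0.symm
    have h2 := congrFun (congrArg Prod.fst h1) 0
    simp at h2
  refine ⟨1 + L * C / E + (C + L * C), by have : 0 ≤ L * C / E + (C + L * C) := (by positivity)
                                          linarith, ?_⟩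
  intro φv hφ w w' hw hw' r hr h1 h2
  obtain ⟨e1, e2⟩ := graph_diff hskew φv w w' hw hw'
  have hN : d (projW B (mul B (inv (graphPt B φv w)) (graphPt B φv w'))) 0 ≤ C * r := by
    rw [e2]
    exact h r _ hr h1 h2
  have hlip : |φv w' - φv w| * E ≤ L * (C * r) := by
    by_cases hww : w = w'
    · subst hww; simp; positivity
    · have h3 := mt (hφ w w' hw hw') hww
      rw [not_le, e1, d_single_x hskew hd, one_div, inv_mul_lt_iff₀ hL] at h3
      exact h3.le.trans (by gcongr)
  have hd0 : d (graphPt B φv w) (graphPt B φv w') ≤ C * r + L * (C * r) := by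
    rw [d_left hskew hd]
    set q := mul B (inv (graphPt B φv w)) (graphPt B φv w') with hq
    have e : q = mul B (projW B q) (projL q) := by
      simp only [projW, projL, mul_def', inv]
      ext k
      · simp
      · simp [bil_add_right, bil_neg_left, bil_neg_right, bil_self hskew]
    rw [e]
    refine (d_mul hd _ _).trans (add_le_add hN ?_)
    rw [e1, d_single_x hskew hd]
    exact hlip
  have hx : |φv w' - φv w| ≤ L * C / E * r := by
    rw [div_mul_eq_mul_div, le_div_iff₀ hE0]; linarith
  constructor
  · refine hx.trans ?_
    have : 0 ≤ (1 + (C + L * C)) * r := by positivity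
    nlinarith
  · refine hd0.trans ?_
    have : 0 ≤ (1 + L * C / E) * r := by positivity
    nlinarith

end dist
section curve
variable {B : Fin n → Fin m → Fin m → ℝ}

/-- Euclidean length of the control -/
noncomputable def rho (a : Fin m → ℝ) : ℝ := Real.sqrt (∑ j, (a j) ^ 2)

lemma rho_nonneg (a : Fin m → ℝ) : 0 ≤ rho a := Real.sqrt_nonneg _

lemma abs_le_rho (a : Fin m → ℝ) (j : Fin m) : |a j| ≤ rho a := by
  apply Real.abs_le_sqrt
  exact Finset.single_le_sum (f := fun j => (a j) ^ 2) (fun i _ => sq_nonneg _) (Finset.mem_univ j)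

lemma rho_le_sum (a : Fin m → ℝ) : rho a ≤ ∑ j, |a j| := by
  unfold rho
  rw [Real.sqrt_le_left (Finset.sum_nonneg fun i _ => abs_nonneg _)]
  calc ∑ j, (a j) ^ 2 = ∑ j, |a j| ^ 2 := by simp
    _ ≤ _ := Finset.sum_sq_le_sq_sum_of_nonneg fun i _ => abs_nonneg _

lemma rho_integrable {a : ℝ → Fin m → ℝ} {S : Set ℝ} (h : IntegrableOn a S) :
    IntegrableOn (fun s => rho (a s)) S := by
  have hj : ∀ j, IntegrableOn (fun s => a s j) S := fun j => Integrable.eval h j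
  refine Integrable.mono' (g := fun s => ∑ j, |a s j|)
    (integrable_finsetSum _ fun j _ => (hj j).abs) ?_ ?_
  · have hc : Continuous (rho : (Fin m → ℝ) → ℝ) := by unfold rho; fun_prop
    exact hc.comp_aestronglyMeasurable h.aestronglyMeasurable
  · refine Filter.Eventually.of_forall fun s => ?_
    rw [Real.norm_eq_abs, abs_of_nonneg (rho_nonneg _)]
    exact rho_le_sum _

/-- The vertical velocity -/
noncomputable def vel [NeZero m] (B : Fin n → Fin m → Fin m → ℝ) (k : Fin n) (a z : Fin m → ℝ)
    (f : ℝ) : ℝ :=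
  ∑ j, a j * ((1 / 2) * ∑ l, B k j l * z l + f * B k j 0)

lemma vel_bound [NeZero m] (B : Fin n → Fin m → Fin m → ℝ) (k : Fin n) (a z : Fin m → ℝ) (f Z M : ℝ)
    (hz : ∀ l, |z l| ≤ Z) (hf : |f| ≤ M) : |vel B k a z f| ≤ beta B * (Z + M) * rho a := by
  have hZ : 0 ≤ Z := (abs_nonneg _).trans (hz 0)
  have hM : 0 ≤ M := (abs_nonneg _).trans hf
  calc |vel B k a z f| ≤ ∑ j, (∑ l, |B k j l|) * ((Z + M) * rho a) := by
        unfold vel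
        refine (Finset.abs_sum_le_sum_abs _ _).trans (Finset.sum_le_sum fun j _ => ?_)
        have h1 : |∑ l, B k j l * z l| ≤ (∑ l, |B k j l|) * Z := by
          rw [Finset.sum_mul]
          refine (Finset.abs_sum_le_sum_abs _ _).trans (Finset.sum_le_sum fun l _ => ?_)
          rw [abs_mul]
          exact mul_le_mul_of_nonneg_left (hz l) (abs_nonneg _)
        have h2 : |B k j 0| ≤ ∑ l, |B k j l| :=
          Finset.single_le_sum (f := fun l => |B k j l|) (fun i _ => abs_nonneg _)
            (Finset.mem_univ 0)
        have h3 : |f * B k j 0| ≤ M * ∑ l, |B k j l| := by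
          rw [abs_mul]; gcongr
        have h4 : |(1 / 2) * ∑ l, B k j l * z l + f * B k j 0| ≤ (∑ l, |B k j l|) * (Z + M) := by
          refine (abs_add_le _ _).trans ?_
          rw [abs_mul, abs_of_nonneg (by norm_num : (0:ℝ) ≤ 1/2)]
          have := abs_nonneg (∑ l, B k j l * z l)
          linarith
        rw [abs_mul]
        calc |a j| * _ ≤ rho a * ((∑ l, |B k j l|) * (Z + M)) :=
              mul_le_mul (abs_le_rho a j) h4 (abs_nonneg _) (rho_nonneg _)
          _ = _ := by ring
    _ = (∑ j, ∑ l, |B k j l|) * ((Z + M) * rho a) := by rw [Finset.sum_mul]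
    _ ≤ beta B * ((Z + M) * rho a) := by
        have := row_le_beta B k
        have := rho_nonneg a
        gcongr
    _ = _ := by ring

lemma phi_cont [NeZero m] (φv : Pt m n → ℝ) (C : ℝ)
    (H : ∀ w w' : Pt m n, w.1 0 = 0 → w'.1 0 = 0 → ∀ r : ℝ, 0 ≤ r → (∀ j, |w'.1 j - w.1 j| ≤ r) →
      (∀ k, |vdiff B (φv w) w w' k| ≤ r ^ 2) → |φv w' - φv w| ≤ C * r) :
    ContinuousOn φv {w | w.1 0 = 0} := by
  intro w hw
  rw [ContinuousWithinAt, tendsto_iff_norm_sub_tendsto_zero]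
  set r : Pt m n → ℝ := fun w' => ∑ j, |w'.1 j - w.1 j| + √(∑ k, |vdiff B (φv w) w w' k|) with hr
  have hrc : Continuous r := by
    simp only [hr, vdiff, bil]
    fun_prop
  have hr0 : r w = 0 := by
    simp [hr, vdiff, bil]
  have ht : Filter.Tendsto (fun w' => C * r w') (𝓝[{w | w.1 0 = 0}] w) (𝓝 0) := by
    have : Filter.Tendsto (fun w' => C * r w') (𝓝 w) (𝓝 (C * r w)) :=
      (continuous_const.mul hrc).tendsto w
    rw [hr0, mul_zero] at this
    exact this.mono_left nhdsWithin_le_nhds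
  refine squeeze_zero' (Filter.Eventually.of_forall fun _ => norm_nonneg _) ?_ ht
  filter_upwards [self_mem_nhdsWithin] with w' hw'
  have s1 : 0 ≤ ∑ j, |w'.1 j - w.1 j| := by positivity
  have s2 : 0 ≤ ∑ k, |vdiff B (φv w) w w' k| := by positivity
  refine H w w' hw hw' (r w') (by positivity) ?_ ?_
  · intro j
    have := Finset.single_le_sum (f := fun j => |w'.1 j - w.1 j|) (fun i _ => abs_nonneg _)
      (Finset.mem_univ j)
    have h2 := Real.sqrt_nonneg (∑ k, |vdiff B (φv w) w w' k|)
    simp only [hr]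
    linarith
  · intro k
    have := Finset.single_le_sum (f := fun k => |vdiff B (φv w) w w' k|) (fun i _ => abs_nonneg _)
      (Finset.mem_univ k)
    have h2 := Real.sqrt_nonneg (∑ k, |vdiff B (φv w) w w' k|)
    have h3 := Real.sq_sqrt s2
    simp only [hr]
    nlinarith

lemma phi_growth [NeZero m] (φv : Pt m n → ℝ) (C : ℝ) (hC : 1 ≤ C)
    (H : ∀ w w' : Pt m n, w.1 0 = 0 → w'.1 0 = 0 → ∀ r : ℝ, 0 ≤ r → (∀ j, |w'.1 j - w.1 j| ≤ r) →
      (∀ k, |vdiff B (φv w) w w' k| ≤ r ^ 2) → |φv w' - φv w| ≤ C * r) (R : ℝ) (hR : 0 ≤ R) :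
    ∃ A ≥ (0 : ℝ), ∀ w : Pt m n, w.1 0 = 0 → (∀ j, |w.1 j| ≤ R) → |φv w| ≤ A * (1 + ‖w.2‖) := by
  set D : ℝ := 1 + R + |φv 0| * (beta B * (R * 1)) with hD
  have hb := beta_nonneg B
  have hD1 : 1 ≤ D := by
    have : 0 ≤ R + |φv 0| * (beta B * (R * 1)) := by positivity
    linarith
  refine ⟨|φv 0| + C * D, by positivity, ?_⟩
  intro w hw hwR
  have hn := norm_nonneg w.2
  have h1 := H 0 w rfl hw (D + ‖w.2‖) (by positivity) ?_ ?_
  · have h2 : |φv w| ≤ |φv w - φv 0| + |φv 0| := by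
      have := abs_add_le (φv w - φv 0) (φv 0)
      simpa using this
    have h3 : 0 ≤ (|φv 0| + C * (D - 1)) * ‖w.2‖ :=
      mul_nonneg (add_nonneg (abs_nonneg _) (mul_nonneg (by linarith) (by linarith))) hn
    nlinarith
  · intro j
    have := hwR j
    have h5 : 0 ≤ |φv 0| * (beta B * (R * 1)) := by positivity
    simp only [Prod.fst_zero, Pi.zero_apply, sub_zero]
    linarith
  · intro k
    have e : vdiff B (φv 0) 0 w k = w.2 k - bil B k w.1 (Pi.single 0 (φv 0)) := by
      rw [bil_single]
      simp [vdiff, bil_zero_right]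
    have h4 : |bil B k w.1 (Pi.single 0 (φv 0))| ≤ beta B * (R * |φv 0|) := by
      refine bil_bound B k _ _ R _ hR hwR ?_
      intro j
      rw [Pi.single_apply]
      split_ifs <;> simp
    have h5 : |w.2 k| ≤ ‖w.2‖ := norm_le_pi_norm w.2 k
    have h6 : |vdiff B (φv 0) 0 w k| ≤ D + ‖w.2‖ := by
      rw [e]
      have := abs_sub (w.2 k) (bil B k w.1 (Pi.single 0 (φv 0)))
      rw [hD]
      linarith
    nlinarith

section hor
variable [NeZero m] {φv : Pt m n → ℝ} {t₀ t₁ : ℝ} {γ1 : ℝ → Fin m → ℝ} {γ2 : ℝ → Fin n → ℝ}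
  {a : ℝ → Fin m → ℝ}

lemma ctrl_int (h : IsHorizontalForD B φv t₀ t₁ γ1 γ2 a) (j : Fin m) {u v : ℝ}
    (hu : t₀ ≤ u) (huv : u ≤ v) (hv : v ≤ t₁) : IntervalIntegrable (fun s => a s j) volume u v := by
  rw [intervalIntegrable_iff_integrableOn_Icc_of_le huv]
  have hj : IntegrableOn (fun s => a s j) (Set.Icc t₀ t₁) := Integrable.eval h.integrable j
  exact hj.mono_set (Set.Icc_subset_Icc hu hv)

lemma rho_int (h : IsHorizontalForD B φv t₀ t₁ γ1 γ2 a) {u v : ℝ}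
    (hu : t₀ ≤ u) (huv : u ≤ v) (hv : v ≤ t₁) :
    IntervalIntegrable (fun s => rho (a s)) volume u v := by
  rw [intervalIntegrable_iff_integrableOn_Icc_of_le huv]
  exact (rho_integrable h.integrable).mono_set (Set.Icc_subset_Icc hu hv)

lemma g1_cont (h : IsHorizontalForD B φv t₀ t₁ γ1 γ2 a) :
    ContinuousOn γ1 (Set.Icc t₀ t₁) := by
  rw [continuousOn_pi]
  intro j
  have hj : IntegrableOn (fun s => a s j) (Set.Icc t₀ t₁) := Integrable.eval h.integrable j
  have h1 : ContinuousOn (fun t => γ1 t₀ j + ∫ s in t₀..t, a s j) (Set.Icc t₀ t₁) := by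
    refine continuousOn_const.add ?_
    have := intervalIntegral.continuousOn_primitive_interval (a := t₀) (b := t₁)
      (f := fun s => a s j) (μ := volume) (by rwa [Set.uIcc_of_le h.le])
    rwa [Set.uIcc_of_le h.le] at this
  exact h1.congr fun t ht => h.horiz t ht j

lemma g2_cont (h : IsHorizontalForD B φv t₀ t₁ γ1 γ2 a) (k : Fin n) {t : ℝ}
    (ht : t ∈ Set.Icc t₀ t₁)
    (hi : IntegrableOn (fun s => vel B k (a s) (γ1 s) (φv (γ1 s, γ2 s))) (Set.Icc t₀ t)) :
    ContinuousOn (fun s => γ2 s k) (Set.Icc t₀ t) := by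
  have h1 : ContinuousOn (fun u => γ2 t₀ k + ∫ s in t₀..u, vel B k (a s) (γ1 s) (φv (γ1 s, γ2 s)))
      (Set.Icc t₀ t) := by
    refine continuousOn_const.add ?_
    have := intervalIntegral.continuousOn_primitive_interval (a := t₀) (b := t)
      (f := fun s => vel B k (a s) (γ1 s) (φv (γ1 s, γ2 s))) (μ := volume)
      (by rwa [Set.uIcc_of_le ht.1])
    rwa [Set.uIcc_of_le ht.1] at this
  exact h1.congr fun u hu => h.vert u ⟨hu.1, hu.2.trans ht.2⟩ k

lemma vel_integrable_of_bdd (h : IsHorizontalForD B φv t₀ t₁ γ1 γ2 a)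
    (hφ : ContinuousOn φv {w | w.1 0 = 0}) (D : ℝ)
    (hD : ∀ k, ∀ s ∈ Set.Icc t₀ t₁, |vel B k (a s) (γ1 s) (φv (γ1 s, γ2 s))|
      ≤ D * (1 + ‖γ2 s‖) * rho (a s)) (hD0 : 0 ≤ D)
    {t : ℝ} (ht : t ∈ Set.Icc t₀ t₁)
    (hm : AEMeasurable γ2 (volume.restrict (Set.Icc t₀ t)))
    (M : ℝ) (hM : ∀ᵐ s ∂(volume.restrict (Set.Icc t₀ t)), ‖γ2 s‖ ≤ M) (k : Fin n) :
    IntegrableOn (fun s => vel B k (a s) (γ1 s) (φv (γ1 s, γ2 s))) (Set.Icc t₀ t) := by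
  classical
  have hsub : Set.Icc t₀ t ⊆ Set.Icc t₀ t₁ := Set.Icc_subset_Icc le_rfl ht.2
  have hI := h.integrable.mono_set hsub
  refine Integrable.mono' (g := fun s => D * (1 + M) * rho (a s))
    ((rho_integrable hI).const_mul _) ?_ ?_
  · have hmem : ∀ᵐ s ∂(volume.restrict (Set.Icc t₀ t)), s ∈ Set.Icc t₀ t :=
      ae_restrict_mem measurableSet_Icc
    have hW : MeasurableSet {w : Pt m n | w.1 0 = 0} := by
      apply IsClosed.measurableSet
      exact isClosed_eq (by fun_prop) continuous_const
    have hg1 : AEMeasurable γ1 (volume.restrict (Set.Icc t₀ t)) :=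
      ((g1_cont h).mono hsub).aemeasurable measurableSet_Icc
    have hpw : Measurable (({w : Pt m n | w.1 0 = 0}).piecewise φv (fun _ => (0:ℝ))) :=
      hφ.measurable_piecewise continuousOn_const hW
    have hf : AEMeasurable (fun s => φv (γ1 s, γ2 s)) (volume.restrict (Set.Icc t₀ t)) := by
      refine (hpw.comp_aemeasurable (hg1.prodMk hm)).congr ?_
      filter_upwards [hmem] with s hs
      have : (γ1 s, γ2 s) ∈ {w : Pt m n | w.1 0 = 0} := h.mem_W s (hsub hs)
      simp only [Function.comp]
      rw [Set.piecewise_eq_of_mem _ _ _ this]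
    have hajm : ∀ j, AEMeasurable (fun s => a s j) (volume.restrict (Set.Icc t₀ t)) := fun j =>
      (Integrable.eval hI j).aemeasurable
    have hgjm : ∀ j, AEMeasurable (fun s => γ1 s j) (volume.restrict (Set.Icc t₀ t)) := fun j =>
      (measurable_pi_apply j).comp_aemeasurable hg1
    refine AEMeasurable.aestronglyMeasurable ?_
    unfold vel
    refine Finset.aemeasurable_fun_sum _ fun j _ => ?_
    refine (hajm j).mul (AEMeasurable.add ?_ (hf.mul_const _))
    refine AEMeasurable.const_mul ?_ _
    exact Finset.aemeasurable_fun_sum _ fun l _ => (hgjm l).const_mul _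
  · filter_upwards [hM, ae_restrict_mem measurableSet_Icc] with s hs hs'
    refine (hD k s (hsub hs')).trans ?_
    have := rho_nonneg (a s)
    gcongr

lemma ext_step (h : IsHorizontalForD B φv t₀ t₁ γ1 γ2 a)
    (hφ : ContinuousOn φv {w | w.1 0 = 0}) (D : ℝ)
    (hD : ∀ k, ∀ s ∈ Set.Icc t₀ t₁, |vel B k (a s) (γ1 s) (φv (γ1 s, γ2 s))|
      ≤ D * (1 + ‖γ2 s‖) * rho (a s)) (hD0 : 0 ≤ D)
    {t : ℝ} (ht : t ∈ Set.Ico t₀ t₁)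
    (hP : ∀ k, IntegrableOn (fun s => vel B k (a s) (γ1 s) (φv (γ1 s, γ2 s))) (Set.Icc t₀ t)) :
    ∃ t' ∈ Set.Ioc t t₁,
      ∀ k, IntegrableOn (fun s => vel B k (a s) (γ1 s) (φv (γ1 s, γ2 s))) (Set.Icc t₀ t') := by
  have hex : ∀ k, ∃ u ∈ Set.Ioc t t₁,
      IntegrableOn (fun s => vel B k (a s) (γ1 s) (φv (γ1 s, γ2 s))) (Set.Icc t₀ u) ∨
      ∀ s ∈ Set.Ioc t t₁,
        ¬ IntegrableOn (fun s => vel B k (a s) (γ1 s) (φv (γ1 s, γ2 s))) (Set.Icc t₀ s) := by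
    intro k
    by_cases hk : ∃ u ∈ Set.Ioc t t₁,
      IntegrableOn (fun s => vel B k (a s) (γ1 s) (φv (γ1 s, γ2 s))) (Set.Icc t₀ u)
    · obtain ⟨u, hu, hu'⟩ := hk
      exact ⟨u, hu, Or.inl hu'⟩
    · push Not at hk
      exact ⟨t₁, ⟨ht.2, le_rfl⟩, Or.inr hk⟩
  choose u hu hu' using hex
  have hev : ∀ᶠ s in 𝓝[>] t, (∀ k, s ∈ Set.Ioc t (u k)) ∧ s ∈ Set.Ioc t t₁ := by
    refine Filter.Eventually.and ?_ (Ioc_mem_nhdsGT ht.2)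
    rw [Filter.eventually_all]
    intro k
    exact Ioc_mem_nhdsGT (hu k).1
  obtain ⟨t', hk', ht'⟩ := hev.exists
  have ht'I : t' ∈ Set.Icc t₀ t₁ := ⟨ht.1.trans ht'.1.le, ht'.2⟩
  refine ⟨t', ht', ?_⟩
  have key : ∀ k, AEMeasurable (fun s => γ2 s k) (volume.restrict (Set.Icc t₀ t')) ∧
      ∃ M, ∀ s ∈ Set.Icc t₀ t', |γ2 s k| ≤ M := by
    intro k
    rcases hu' k with hc | hc
    · have hcont := (g2_cont h k ⟨ht.1.trans (hu k).1.le, (hu k).2⟩ hc).mono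
        (Set.Icc_subset_Icc_right (hk' k).2)
      refine ⟨hcont.aemeasurable measurableSet_Icc, ?_⟩
      obtain ⟨M, hM⟩ := isCompact_Icc.exists_bound_of_continuousOn hcont
      exact ⟨M, hM⟩
    · have hcont := g2_cont h k ⟨ht.1, ht.2.le⟩ (hP k)
      have hconst : ∀ s ∈ Set.Ioc t t', γ2 s k = γ2 t₀ k := by
        intro s hs
        have hsI : s ∈ Set.Icc t₀ t₁ := ⟨ht.1.trans hs.1.le, hs.2.trans ht'.2⟩
        have h1 := h.vert s hsI k
        have h2 := hc s ⟨hs.1, hsI.2⟩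
        rw [← intervalIntegrable_iff_integrableOn_Icc_of_le hsI.1] at h2
        have h3 := intervalIntegral.integral_undef h2
        unfold vel at h3
        rw [h1, h3, add_zero]
      constructor
      · rw [← Set.Icc_union_Ioc_eq_Icc ht.1 ht'.1.le, aemeasurable_union_iff]
        refine ⟨hcont.aemeasurable measurableSet_Icc, ?_⟩
        have : ContinuousOn (fun s => γ2 s k) (Set.Ioc t t') :=
          (continuousOn_const (c := γ2 t₀ k)).congr hconst
        exact this.aemeasurable measurableSet_Ioc
      · obtain ⟨M, hM⟩ := isCompact_Icc.exists_bound_of_continuousOn hcont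
        refine ⟨max M |γ2 t₀ k|, fun s hs => ?_⟩
        by_cases hst : s ≤ t
        · exact (hM s ⟨hs.1, hst⟩).trans (le_max_left _ _)
        · rw [hconst s ⟨not_le.1 hst, hs.2⟩]
          exact le_max_right _ _
  choose hmeas M hM using key
  refine vel_integrable_of_bdd h hφ D hD hD0 ht'I (aemeasurable_pi_iff.2 hmeas) (∑ k, |M k|) ?_
  filter_upwards [ae_restrict_mem measurableSet_Icc] with s hs
  rw [pi_norm_le_iff_of_nonneg (by positivity)]
  intro k
  refine (hM k s hs).trans ((le_abs_self _).trans ?_)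
  exact Finset.single_le_sum (f := fun k => |M k|) (fun i _ => abs_nonneg _) (Finset.mem_univ k)

lemma sup_step (h : IsHorizontalForD B φv t₀ t₁ γ1 γ2 a)
    (hφ : ContinuousOn φv {w | w.1 0 = 0}) (D : ℝ)
    (hD : ∀ k, ∀ s ∈ Set.Icc t₀ t₁, |vel B k (a s) (γ1 s) (φv (γ1 s, γ2 s))|
      ≤ D * (1 + ‖γ2 s‖) * rho (a s)) (hD0 : 0 ≤ D)
    {T : ℝ} (hT : T ∈ Set.Ioc t₀ t₁)
    (hP : ∀ t ∈ Set.Ico t₀ T,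
      ∀ k, IntegrableOn (fun s => vel B k (a s) (γ1 s) (φv (γ1 s, γ2 s))) (Set.Icc t₀ t)) (k : Fin n) :
    IntegrableOn (fun s => vel B k (a s) (γ1 s) (φv (γ1 s, γ2 s))) (Set.Icc t₀ T) := by
  have hTI : T ∈ Set.Icc t₀ t₁ := ⟨hT.1.le, hT.2⟩
  have hc : ∀ t ∈ Set.Ico t₀ T, ContinuousOn γ2 (Set.Icc t₀ t) := by
    intro t ht
    rw [continuousOn_pi]
    exact fun k => g2_cont h k ⟨ht.1, ht.2.le.trans hT.2⟩ (hP t ht k)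
  have hcI : ContinuousOn γ2 (Set.Ico t₀ T) := by
    intro s hs
    have h1 : s < (s + T) / 2 := by linarith [hs.2]
    have h2 : (s + T) / 2 < T := by linarith [hs.2]
    refine (hc ((s + T) / 2) ⟨by linarith [hs.1], h2⟩ s ⟨hs.1, h1.le⟩).mono_of_mem_nhdsWithin ?_
    filter_upwards [self_mem_nhdsWithin, mem_nhdsWithin_of_mem_nhds (Iio_mem_nhds h1)] with x hx hx'
    exact ⟨hx.1, le_of_lt hx'⟩
  have hmeas : AEMeasurable γ2 (volume.restrict (Set.Icc t₀ T)) := by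
    rw [← restrict_Ico_eq_restrict_Icc]
    exact hcI.aemeasurable measurableSet_Ico
  -- choose u close to T
  have hpr : ContinuousOn (fun u => ∫ s in t₀..u, rho (a s)) (Set.Icc t₀ T) := by
    have hI : IntegrableOn (fun s => rho (a s)) (Set.Icc t₀ T) :=
      (rho_integrable h.integrable).mono_set (Set.Icc_subset_Icc_right hT.2)
    have := intervalIntegral.continuousOn_primitive_interval (a := t₀) (b := T)
      (f := fun s => rho (a s)) (μ := volume) (by rwa [Set.uIcc_of_le hT.1.le])
    rwa [Set.uIcc_of_le hT.1.le] at this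
  obtain ⟨u, hu, huT⟩ : ∃ u ∈ Set.Ico t₀ T, D * ∫ s in u..T, rho (a s) ≤ 1 / 2 := by
    have h1 : Filter.Tendsto (fun u => D * ((∫ s in t₀..T, rho (a s)) - ∫ s in t₀..u, rho (a s)))
        (𝓝[Set.Icc t₀ T] T) (𝓝 (D * ((∫ s in t₀..T, rho (a s)) - ∫ s in t₀..T, rho (a s)))) :=
      ((hpr T ⟨hT.1.le, le_rfl⟩).const_sub _).const_mul D
    rw [sub_self, mul_zero] at h1
    have h2 : ∀ᶠ u in 𝓝[Set.Icc t₀ T] T,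
        D * ((∫ s in t₀..T, rho (a s)) - ∫ s in t₀..u, rho (a s)) < 1 / 2 :=
      h1.eventually (Iio_mem_nhds (by norm_num))
    have h3 : ∀ᶠ u in 𝓝[<] T, D * ((∫ s in t₀..T, rho (a s)) - ∫ s in t₀..u, rho (a s)) < 1 / 2 := by
      refine Filter.Eventually.filter_mono ?_ h2
      refine nhdsWithin_le_iff.2 ?_
      exact Icc_mem_nhdsLT hT.1
    obtain ⟨u, hu1, hu2⟩ := (h3.and (Ico_mem_nhdsLT hT.1)).exists
    refine ⟨u, hu2, ?_⟩
    rw [← intervalIntegral.integral_interval_sub_left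
      (rho_int h le_rfl hT.1.le hT.2) (rho_int h le_rfl hu2.1 (hu2.2.le.trans hT.2))]
    exact hu1.le
  obtain ⟨M0, hM0⟩ := isCompact_Icc.exists_bound_of_continuousOn (hc u hu)
  have hbd : ∀ t ∈ Set.Ico u T, ‖γ2 t‖ ≤ 2 * ‖γ2 u‖ + 1 := by
    intro t ht
    have htI : t ∈ Set.Ico t₀ T := ⟨hu.1.trans ht.1, ht.2⟩
    obtain ⟨s, hs, hmax⟩ := isCompact_Icc.exists_isMaxOn (Set.nonempty_Icc.2 ht.1)
      ((hc t htI).mono (Set.Icc_subset_Icc_left hu.1)).norm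
    have hmax' : ∀ r ∈ Set.Icc u t, ‖γ2 r‖ ≤ ‖γ2 s‖ := fun r hr => hmax hr
    have hsI : s ∈ Set.Icc t₀ t₁ := ⟨hu.1.trans hs.1, hs.2.trans (ht.2.le.trans hT.2)⟩
    have hsT : s ≤ T := hs.2.trans ht.2.le
    have hgs : ‖γ2 s‖ ≤ ‖γ2 u‖ + 1 / 2 * (1 + ‖γ2 s‖) := by
      rw [pi_norm_le_iff_of_nonneg (by positivity)]
      intro k
      have i1 : IntervalIntegrable (fun s => vel B k (a s) (γ1 s) (φv (γ1 s, γ2 s))) volume t₀ s := by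
        rw [intervalIntegrable_iff_integrableOn_Icc_of_le hsI.1]
        exact (hP t htI k).mono_set (Set.Icc_subset_Icc_right hs.2)
      have i2 : IntervalIntegrable (fun s => vel B k (a s) (γ1 s) (φv (γ1 s, γ2 s))) volume t₀ u := by
        rw [intervalIntegrable_iff_integrableOn_Icc_of_le hu.1]
        exact hP u hu k
      have e : γ2 s k = γ2 u k + ∫ r in u..s, vel B k (a r) (γ1 r) (φv (γ1 r, γ2 r)) := by
        rw [← intervalIntegral.integral_interval_sub_left i1 i2]
        have e1 := h.vert s hsI k
        have e2 := h.vert u ⟨hu.1, hu.2.le.trans hT.2⟩ k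
        unfold vel
        rw [e1, e2]; ring
      have hb : ‖∫ r in u..s, vel B k (a r) (γ1 r) (φv (γ1 r, γ2 r))‖
          ≤ ∫ r in u..s, D * (1 + ‖γ2 s‖) * rho (a r) := by
        refine intervalIntegral.norm_integral_le_of_norm_le hs.1 ?_
          ((rho_int h hu.1 hs.1 hsI.2).const_mul _)
        refine Filter.Eventually.of_forall fun r hr => ?_
        refine (hD k r ⟨hu.1.trans hr.1.le, hr.2.trans hsI.2⟩).trans ?_
        have h1 := hmax' r ⟨hr.1.le, hr.2.trans hs.2⟩
        have h2 := rho_nonneg (a r)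
        gcongr
      rw [intervalIntegral.integral_const_mul] at hb
      have hmono : ∫ r in u..s, rho (a r) ≤ ∫ r in u..T, rho (a r) := by
        refine intervalIntegral.integral_mono_interval le_rfl hs.1 hsT ?_
          (rho_int h hu.1 hu.2.le hT.2)
        exact Filter.Eventually.of_forall fun r => rho_nonneg _
      have h5 : D * (1 + ‖γ2 s‖) * ∫ r in u..s, rho (a r) ≤ 1 / 2 * (1 + ‖γ2 s‖) := by
        calc D * (1 + ‖γ2 s‖) * ∫ r in u..s, rho (a r)
            ≤ D * (1 + ‖γ2 s‖) * ∫ r in u..T, rho (a r) := by gcongr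
          _ = (D * ∫ r in u..T, rho (a r)) * (1 + ‖γ2 s‖) := by ring
          _ ≤ _ := by gcongr
      rw [e]
      refine (norm_add_le _ _).trans (add_le_add (norm_le_pi_norm _ _) (hb.trans h5))
    have := hmax' t ⟨ht.1, le_rfl⟩
    linarith
  refine vel_integrable_of_bdd h hφ D hD hD0 hTI hmeas (max M0 (2 * ‖γ2 u‖ + 1)) ?_ k
  rw [← restrict_Ico_eq_restrict_Icc]
  filter_upwards [ae_restrict_mem measurableSet_Ico] with s hs
  by_cases hsu : s ≤ u
  · exact (hM0 s ⟨hs.1, hsu⟩).trans (le_max_left _ _)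
  · exact (hbd s ⟨(not_le.1 hsu).le, hs.2⟩).trans (le_max_right _ _)

lemma vel_integrable (h : IsHorizontalForD B φv t₀ t₁ γ1 γ2 a) (C : ℝ) (hC : 1 ≤ C)
    (H : ∀ w w' : Pt m n, w.1 0 = 0 → w'.1 0 = 0 → ∀ r : ℝ, 0 ≤ r → (∀ j, |w'.1 j - w.1 j| ≤ r) →
      (∀ k, |vdiff B (φv w) w w' k| ≤ r ^ 2) → |φv w' - φv w| ≤ C * r) :
    ∀ k, IntegrableOn (fun s => vel B k (a s) (γ1 s) (φv (γ1 s, γ2 s))) (Set.Icc t₀ t₁) := by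
  have hφ := phi_cont φv C H
  obtain ⟨R, hR⟩ := isCompact_Icc.exists_bound_of_continuousOn (g1_cont h)
  have hR0 : 0 ≤ R := (norm_nonneg _).trans (hR t₀ ⟨le_rfl, h.le⟩)
  obtain ⟨A, hA, hg⟩ := phi_growth φv C hC H R hR0
  have hb := beta_nonneg B
  have hRj : ∀ s ∈ Set.Icc t₀ t₁, ∀ j, |γ1 s j| ≤ R := fun s hs j =>
    (norm_le_pi_norm (γ1 s) j).trans (hR s hs)
  have hD0 : 0 ≤ beta B * (R + A) := by positivity
  have hD : ∀ k, ∀ s ∈ Set.Icc t₀ t₁, |vel B k (a s) (γ1 s) (φv (γ1 s, γ2 s))|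
      ≤ (beta B * (R + A)) * (1 + ‖γ2 s‖) * rho (a s) := by
    intro k s hs
    refine (vel_bound B k _ _ _ R _ (hRj s hs) (hg _ (h.mem_W s hs) (hRj s hs))).trans ?_
    refine mul_le_mul_of_nonneg_right ?_ (rho_nonneg _)
    rw [mul_assoc]
    refine mul_le_mul_of_nonneg_left ?_ hb
    have := mul_nonneg hR0 (norm_nonneg (γ2 s))
    simp only
    linarith
  set S : Set ℝ := {t | t ∈ Set.Icc t₀ t₁ ∧
    ∀ k, IntegrableOn (fun s => vel B k (a s) (γ1 s) (φv (γ1 s, γ2 s))) (Set.Icc t₀ t)} with hS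
  have h0 : t₀ ∈ S := ⟨⟨le_rfl, h.le⟩, fun k => by
    rw [Set.Icc_self]
    exact integrableOn_singleton (hx := by simp)⟩
  have hbdd : BddAbove S := ⟨t₁, fun t ht => ht.1.2⟩
  set T := sSup S with hTdef
  have hT0 : t₀ ≤ T := le_csSup hbdd h0
  have hT1 : T ≤ t₁ := csSup_le ⟨t₀, h0⟩ fun t ht => ht.1.2
  have hlt : ∀ t ∈ Set.Ico t₀ T,
      ∀ k, IntegrableOn (fun s => vel B k (a s) (γ1 s) (φv (γ1 s, γ2 s))) (Set.Icc t₀ t) := by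
    intro t ht k
    obtain ⟨t', ht', htt'⟩ := exists_lt_of_lt_csSup ⟨t₀, h0⟩ ht.2
    exact (ht'.2 k).mono_set (Set.Icc_subset_Icc_right htt'.le)
  have hTS : ∀ k, IntegrableOn (fun s => vel B k (a s) (γ1 s) (φv (γ1 s, γ2 s))) (Set.Icc t₀ T) := by
    rcases hT0.eq_or_lt with he | hl
    · rw [← he]; exact h0.2
    · exact sup_step h hφ _ hD hD0 ⟨hl, hT1⟩ hlt
  rcases hT1.eq_or_lt with he | hl
  · rwa [← he]
  · obtain ⟨t', ht', hP'⟩ := ext_step h hφ _ hD hD0 ⟨hT0, hl⟩ hTS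
    have : t' ≤ T := le_csSup hbdd ⟨⟨hT0.trans ht'.1.le, ht'.2⟩, hP'⟩
    exact absurd ht'.1 (not_lt.2 this)

lemma main_est (h : IsHorizontalForD B φv t₀ t₁ γ1 γ2 a) (d : Pt m n → Pt m n → ℝ)
    (C : ℝ) (hC : 1 ≤ C)
    (H : ∀ w w' : Pt m n, w.1 0 = 0 → w'.1 0 = 0 → ∀ r : ℝ, 0 ≤ r → (∀ j, |w'.1 j - w.1 j| ≤ r) →
      (∀ k, |vdiff B (φv w) w w' k| ≤ r ^ 2) → |φv w' - φv w| ≤ C * r ∧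
        d (graphPt B φv w) (graphPt B φv w') ≤ C * r)
    {s t : ℝ} (hs : t₀ ≤ s) (hst : s ≤ t) (ht : t ≤ t₁) :
    |φv (γ1 t, γ2 t) - φv (γ1 s, γ2 s)| ≤
        2 * C * (1 + beta B + beta B * C) * (∫ r in s..t, rho (a r)) ∧
      d (graphPt B φv (γ1 s, γ2 s)) (graphPt B φv (γ1 t, γ2 t)) ≤
        2 * C * (1 + beta B + beta B * C) * (∫ r in s..t, rho (a r)) := by
  have hI := vel_integrable h C hC fun w w' hw hw' r hr h1 h2 => (H w w' hw hw' r hr h1 h2).1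
  have hφ := phi_cont φv C fun w w' hw hw' r hr h1 h2 => (H w w' hw hw' r hr h1 h2).1
  have hg1 := g1_cont h
  have hg2 : ContinuousOn γ2 (Set.Icc t₀ t₁) := by
    rw [continuousOn_pi]
    exact fun k => g2_cont h k ⟨h.le, le_rfl⟩ (hI k)
  have hf : ContinuousOn (fun r => φv (γ1 r, γ2 r)) (Set.Icc t₀ t₁) :=
    hφ.comp (hg1.prodMk hg2) fun r hr => h.mem_W r hr
  have hsI : s ∈ Set.Icc t₀ t₁ := ⟨hs, hst.trans ht⟩
  have hsub : Set.Icc s t ⊆ Set.Icc t₀ t₁ := Set.Icc_subset_Icc hs ht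
  obtain ⟨q, hq, hmax⟩ := isCompact_Icc.exists_isMaxOn (Set.nonempty_Icc.2 hst)
    ((hf.mono hsub).sub (continuousOn_const (c := φv (γ1 s, γ2 s)))).norm
  set M := |φv (γ1 q, γ2 q) - φv (γ1 s, γ2 s)| with hM
  have hmax' : ∀ r ∈ Set.Icc s t, |φv (γ1 r, γ2 r) - φv (γ1 s, γ2 s)| ≤ M := fun r hr => hmax hr
  have hM0 : 0 ≤ M := abs_nonneg _
  set A := ∫ r in s..t, rho (a r) with hA
  have hA0 : 0 ≤ A := intervalIntegral.integral_nonneg hst fun r _ => rho_nonneg _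
  have hb := beta_nonneg B
  have hAmono : ∀ p ∈ Set.Icc s t, ∫ r in s..p, rho (a r) ≤ A := by
    intro p hp
    refine intervalIntegral.integral_mono_interval le_rfl hp.1 hp.2 ?_ (rho_int h hs hst ht)
    exact Filter.Eventually.of_forall fun r => rho_nonneg _
  have hxe : ∀ p ∈ Set.Icc s t, ∀ j, γ1 p j - γ1 s j = ∫ r in s..p, a r j := by
    intro p hp j
    rw [← intervalIntegral.integral_interval_sub_left (ctrl_int h j le_rfl (hsub hp).1 (hsub hp).2)
      (ctrl_int h j le_rfl hsI.1 hsI.2), h.horiz p (hsub hp) j, h.horiz s hsI j]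
    ring
  have hx : ∀ p ∈ Set.Icc s t, ∀ j, |γ1 p j - γ1 s j| ≤ A := by
    intro p hp j
    rw [hxe p hp j]
    have hbd : ‖∫ r in s..p, a r j‖ ≤ ∫ r in s..p, rho (a r) := by
      refine intervalIntegral.norm_integral_le_of_norm_le hp.1 ?_ (rho_int h hs hp.1 (hsub hp).2)
      exact Filter.Eventually.of_forall fun r _ => abs_le_rho _ _
    exact le_trans hbd (hAmono p hp)
  have hv : ∀ p ∈ Set.Icc s t, ∀ k,
      |vdiff B (φv (γ1 s, γ2 s)) (γ1 s, γ2 s) (γ1 p, γ2 p) k| ≤ beta B * (A + M) * A := by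
    intro p hp k
    have iv : ∀ v ∈ Set.Icc t₀ t₁,
        IntervalIntegrable (fun s => vel B k (a s) (γ1 s) (φv (γ1 s, γ2 s))) volume t₀ v := by
      intro v hv
      rw [intervalIntegrable_iff_integrableOn_Icc_of_le hv.1]
      exact (hI k).mono_set (Set.Icc_subset_Icc_right hv.2)
    have ivs : IntervalIntegrable (fun s => vel B k (a s) (γ1 s) (φv (γ1 s, γ2 s))) volume s p :=
      (iv s hsI).symm.trans (iv p (hsub hp))
    set c : Fin m → ℝ := fun j => (1 / 2) * ∑ l, B k j l * γ1 s l + φv (γ1 s, γ2 s) * B k j 0 with hc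
    have ija : ∀ j ∈ Finset.univ, IntervalIntegrable (fun r => a r j * c j) volume s p := fun j _ =>
      (ctrl_int h j hs hp.1 (hsub hp).2).mul_const _
    have e1 : γ2 p k - γ2 s k = ∫ r in s..p, vel B k (a r) (γ1 r) (φv (γ1 r, γ2 r)) := by
      rw [← intervalIntegral.integral_interval_sub_left (iv p (hsub hp)) (iv s hsI)]
      have e1 := h.vert p (hsub hp) k
      have e2 := h.vert s hsI k
      unfold vel
      rw [e1, e2]; ring
    have e2 : ∫ r in s..p, ∑ j, a r j * c j = ∑ j, (γ1 p j - γ1 s j) * c j := by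
      rw [intervalIntegral.integral_finsetSum ija]
      refine Finset.sum_congr rfl fun j _ => ?_
      rw [intervalIntegral.integral_mul_const, hxe p hp j]
    have e3 : vdiff B (φv (γ1 s, γ2 s)) (γ1 s, γ2 s) (γ1 p, γ2 p) k
        = ∫ r in s..p, vel B k (a r) (γ1 r - γ1 s) (φv (γ1 r, γ2 r) - φv (γ1 s, γ2 s)) := by
      have e4 : ∀ r, vel B k (a r) (γ1 r - γ1 s) (φv (γ1 r, γ2 r) - φv (γ1 s, γ2 s))
          = vel B k (a r) (γ1 r) (φv (γ1 r, γ2 r)) - ∑ j, a r j * c j := by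
        intro r
        simp only [vel, hc]
        rw [← Finset.sum_sub_distrib]
        refine Finset.sum_congr rfl fun j _ => ?_
        simp only [Pi.sub_apply, mul_sub, Finset.sum_sub_distrib]
        ring
      simp only [e4]
      have isum : IntervalIntegrable (fun r => ∑ j, a r j * c j) volume s p := by
        have h1 := IntervalIntegrable.sum _ ija
        have h2 : (∑ j, fun r => a r j * c j) = fun r => ∑ j, a r j * c j := by
          ext r
          simp
        rwa [h2] at h1
      rw [intervalIntegral.integral_sub ivs isum, ← e1, e2]
      have q1 : (1 / 2) * bil B k (γ1 p - γ1 s) (γ1 s)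
          = ∑ j, (γ1 p j - γ1 s j) * ((1 / 2) * ∑ l, B k j l * γ1 s l) := by
        unfold bil
        rw [Finset.mul_sum]
        refine Finset.sum_congr rfl fun j _ => ?_
        rw [Finset.mul_sum, Finset.mul_sum, Finset.mul_sum]
        refine Finset.sum_congr rfl fun l _ => ?_
        simp only [Pi.sub_apply]; ring
      have q2 : φv (γ1 s, γ2 s) * ∑ j, B k j 0 * (γ1 p j - γ1 s j)
          = ∑ j, (γ1 p j - γ1 s j) * (φv (γ1 s, γ2 s) * B k j 0) := by
        rw [Finset.mul_sum]
        refine Finset.sum_congr rfl fun j _ => ?_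
        ring
      simp only [vdiff]
      rw [q1, q2, sub_sub _ (Finset.sum _ _), ← Finset.sum_add_distrib]
      simp only [hc, mul_add]
    rw [e3]
    have hbd : ‖∫ r in s..p, vel B k (a r) (γ1 r - γ1 s) (φv (γ1 r, γ2 r) - φv (γ1 s, γ2 s))‖
        ≤ ∫ r in s..p, beta B * (A + M) * rho (a r) := by
      refine intervalIntegral.norm_integral_le_of_norm_le hp.1 ?_
        ((rho_int h hs hp.1 (hsub hp).2).const_mul _)
      refine Filter.Eventually.of_forall fun r hr => ?_
      have hr' : r ∈ Set.Icc s t := ⟨hr.1.le, hr.2.trans hp.2⟩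
      exact vel_bound B k _ _ _ _ _ (fun l => hx r hr' l) (hmax' r hr')
    rw [intervalIntegral.integral_const_mul] at hbd
    refine le_trans hbd ?_
    have := hAmono p hp
    gcongr
  set C1 := 1 + beta B + beta B * C with hC1
  have hCpos : 0 < C := by linarith
  have hbC : 0 ≤ beta B * C := by positivity
  set ε := 1 / (2 * C) with hε
  have hε0 : 0 ≤ ε := by positivity
  have hεC : C * ε = 1 / 2 := by rw [hε]; field_simp
  have hr0 : 0 ≤ ε * M + C1 * A := by positivity
  have hrA : A ≤ ε * M + C1 * A := by
    have : 0 ≤ ε * M + (beta B + beta B * C) * A := by positivity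
    rw [hC1]; linarith
  have hrsq : beta B * (A + M) * A ≤ (ε * M + C1 * A) ^ 2 := by
    have h1 : beta B ≤ C1 ^ 2 := by nlinarith
    have h2 : beta B ≤ 2 * ε * C1 := by
      have : 2 * ε * (beta B * C) = beta B := by
        calc 2 * ε * (beta B * C) = 2 * beta B * (C * ε) := by ring
          _ = _ := by rw [hεC]; ring
      have : 0 ≤ 2 * ε * (1 + beta B) := by positivity
      rw [hC1]; linarith
    have h3 : beta B * (A * A) ≤ C1 ^ 2 * (A * A) := by gcongr
    have h4 : beta B * (M * A) ≤ 2 * ε * C1 * (M * A) := by gcongr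
    have h5 : 0 ≤ (ε * M) ^ 2 := by positivity
    linarith
  have hmain : ∀ p ∈ Set.Icc s t, _ := fun p hp =>
    H (γ1 s, γ2 s) (γ1 p, γ2 p) (h.mem_W s hsI) (h.mem_W p (hsub hp)) (ε * M + C1 * A) hr0
      (fun j => (hx p hp j).trans hrA) (fun k => (hv p hp k).trans hrsq)
  have hMle : M ≤ 2 * C * C1 * A := by
    have h1 := (hmain q hq).1
    have h2 : C * (ε * M + C1 * A) = 1 / 2 * M + C * C1 * A := by
      rw [← hεC]; ring
    rw [h2] at h1
    linarith
  have htI : t ∈ Set.Icc s t := ⟨hst, le_rfl⟩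
  refine ⟨(hmax' t htI).trans hMle, (hmain t htI).2.trans ?_⟩
  have h2 : C * (ε * M + C1 * A) = 1 / 2 * M + C * C1 * A := by
    rw [← hεC]; ring
  rw [h2]; linarith

end hor
end curve

/-- in a step-2 Carnot group with a left-invariant homogeneous distance `d`,
if `φ̃ : 𝕎 → 𝕃` is intrinsic `L`-Lipschitz and `γ̃` is a horizontal curve for
`{D_j^φ}_{j=2,…,m}`, then (i) the `d`-length of the graph curve `t ↦ γ̃(t)·φ̃(γ̃(t))`
(i.e. the supremum over partitions of the sums of distances) is at most `C·ℓ_φ(γ̃)` with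
`C = C(G, L)`, and (ii) if the controls are bounded by `K`, then `s ↦ φ(γ̃(s))` is
`L'`-Lipschitz with `L' = L'(L, K, G)`. -/
theorem stmt13 {m n : ℕ} [NeZero m]
    (B : Fin n → Fin m → Fin m → ℝ)
    (hskew : ∀ k j l, B k j l = -B k l j)
    (hindep : LinearIndependent ℝ B)
    (d : Pt m n → Pt m n → ℝ) (hd : IsLIHomDist B d)
    (L : ℝ) (hL : 0 < L) :
    (∃ C > (0 : ℝ), ∀ φv : Pt m n → ℝ, IsIntrinsicLip B d L φv →
      ∀ t₀ t₁ γ1 γ2 a, IsHorizontalForD B φv t₀ t₁ γ1 γ2 a →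
        ∀ (N : ℕ) (σ : ℕ → ℝ), Monotone σ → σ 0 = t₀ → σ N = t₁ →
          ∑ i ∈ Finset.range N,
              d (graphPt B φv (γ1 (σ i), γ2 (σ i)))
                (graphPt B φv (γ1 (σ (i + 1)), γ2 (σ (i + 1))))
            ≤ C * phiLength t₀ t₁ a) ∧
    (∀ K : ℝ, 0 ≤ K → ∃ L' ≥ (0 : ℝ), ∀ φv : Pt m n → ℝ, IsIntrinsicLip B d L φv →
      ∀ t₀ t₁ γ1 γ2 a, IsHorizontalForD B φv t₀ t₁ γ1 γ2 a →
        (∀ᵐ t ∂(volume.restrict (Set.Icc t₀ t₁)), Real.sqrt (∑ j, (a t j) ^ 2) ≤ K) →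
        ∀ s ∈ Set.Icc t₀ t₁, ∀ s' ∈ Set.Icc t₀ t₁,
          |φv (γ1 s, γ2 s) - φv (γ1 s', γ2 s')| ≤ L' * |s - s'|) := by
  obtain ⟨C, hC, H⟩ := lip_main hskew hd L hL
  have hb := beta_nonneg B
  have hCpos : 0 < C := by linarith
  refine ⟨⟨2 * C * (1 + beta B + beta B * C), by positivity, ?_⟩, ?_⟩
  · intro φv hφ t₀ t₁ γ1 γ2 a h N σ hσ h0 hN
    have hint : ∀ i < N, IntervalIntegrable (fun s => rho (a s)) volume (σ i) (σ (i + 1)) := by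
      intro i hi
      exact rho_int h (h0 ▸ hσ (Nat.zero_le i)) (hσ (Nat.le_succ i)) (hN ▸ hσ hi)
    have hsum := intervalIntegral.sum_integral_adjacent_intervals hint
    rw [h0, hN] at hsum
    have e : phiLength t₀ t₁ a = ∫ s in t₀..t₁, rho (a s) := rfl
    rw [e, ← hsum, Finset.mul_sum]
    refine Finset.sum_le_sum fun i hi => ?_
    rw [Finset.mem_range] at hi
    exact (main_est h d C hC (H φv hφ) (h0 ▸ hσ (Nat.zero_le i)) (hσ (Nat.le_succ i))
      (hN ▸ hσ hi)).2
  · intro K hK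
    refine ⟨2 * C * (1 + beta B + beta B * C) * K, by positivity, ?_⟩
    intro φv hφ t₀ t₁ γ1 γ2 a h hbd
    have key : ∀ s t, t₀ ≤ s → s ≤ t → t ≤ t₁ → |φv (γ1 t, γ2 t) - φv (γ1 s, γ2 s)| ≤
        2 * C * (1 + beta B + beta B * C) * K * (t - s) := by
      intro s t hs hst ht
      refine (main_est h d C hC (H φv hφ) hs hst ht).1.trans ?_
      rw [mul_assoc _ K]
      refine mul_le_mul_of_nonneg_left ?_ (by positivity)
      have h1 : ∫ r in s..t, rho (a r) ≤ ∫ r in s..t, K := by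
        refine intervalIntegral.integral_mono_ae_restrict hst (rho_int h hs hst ht)
          intervalIntegrable_const ?_
        exact ae_restrict_of_ae_restrict_of_subset (Set.Icc_subset_Icc hs ht) hbd
      rw [intervalIntegral.integral_const, smul_eq_mul, mul_comm] at h1
      exact h1
    intro s hs s' hs'
    rcases le_total s s' with hle | hle
    · rw [abs_sub_comm, abs_sub_comm s, abs_of_nonneg (sub_nonneg.2 hle)]
      exact key s s' hs.1 hle hs'.2
    · rw [abs_of_nonneg (sub_nonneg.2 hle)]
      exact key s' s hs'.1 hle hs.2

end Step2
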